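/- arXiv:0712.3213 — 2 statements merged into one kernel-verified Lean document; each statement's English description precedes it below -/
import Mathlib

section
/- Let m be a positive integer and let a = (a_0, …, a_{m−1}) be nonnegative integers with a_0 + ⋯ + a_{m−1} = n. Let k, l, c be nonnegative integers with k ≤ n and l ≤ m, and suppose that for every j with 0 ≤ j < m one has a_j + a_{j+1} + ⋯ + a_{j+l−1} ≤ k (indices read modulo m; this says the point (k,l) is dominated by every cyclic shift of a). Then the number of pairs (P, j) with 0 ≤ j < m and P a lattice path from (0,0) with terminus (k,l), dominated by σ^j(a), and having exactly c up-right corners, equals m·binomial(k,c)·binomial(l,c) − n·binomial(k−1, c−1)·binomial(l+1, c+1). -/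
/-- A lattice path is a list of steps: `false` = R-step `(1,0)`, `true` = U-step `(0,1)`,
starting at the origin.  `Dominated b P` says that for every `d` with
`0 ≤ d <` (number of U-steps of `P`), the number of R-steps of `P` preceding its
`(d+1)`-st U-step is at least `b 0 + b 1 + ⋯ + b d`. -/
def Dominated (b : ℕ → ℕ) (P : List Bool) : Prop :=
  ∀ q r : List Bool, P = q ++ true :: r →
    ∑ i ∈ Finset.range (q.count true + 1), b i ≤ q.count false

/-- The `j`-th cyclic shift `σ^j(a)` of an `m`-tuple `a`, indices read modulo `m`. -/
def shiftComp (m j : ℕ) (a : ℕ → ℕ) : ℕ → ℕ :=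
  fun i => a ((i + (m - j)) % m)

/-- The number of up-right corners of a path: occurrences of a U-step immediately
followed by an R-step. -/
def upRightCorners (P : List Bool) : ℕ :=
  ((Finset.range P.length).filter
    (fun i => P.getD i false = true ∧ P.getD (i + 1) true = false)).card

/-- `binomial N r` for an integer lower index `r` (zero when `r < 0`). -/
def chooseInt (N : ℕ) (r : ℤ) : ℕ :=
  if 0 ≤ r then N.choose r.toNat else 0

open Finset

/-- The number of chains `(x₁, y₁) < ⋯ < (x_c, y_c)`, strictly increasing in both coordinates,
with `x_i < x`, `1 ≤ y_i ≤ y` and `B y_i ≤ x_i` for all `i`. -/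
def cornerChains (B : ℕ → ℕ) : ℕ → ℕ → ℕ → ℕ
  | 0, _, _ => 1
  | c + 1, x, y => ∑ x' ∈ range x, ∑ y' ∈ range y,
      if B (y' + 1) ≤ x' then cornerChains B c x' y' else 0

/-- The number of chains `(u₁, v₁) < ⋯ < (u_r, v_r)`, strictly increasing in both coordinates,
with `u < u₁`, `v ≤ v₁`, `v_r < h` and `u_i ≤ F v_i` for all `i`. -/
def chainsBelow (F : ℕ → ℕ) (h : ℕ) : ℕ → ℕ → ℕ → ℕ
  | 0, _, _ => 1
  | r + 1, u, v => ∑ v' ∈ Ico v h, ∑ u' ∈ Ioc u (F v'), chainsBelow F h r u' (v' + 1)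

theorem sum_range_mul_choose (g : ℕ → ℕ) (d k : ℕ) :
    ∑ x' ∈ range k, ∑ x ∈ range x', g x * (x' - 1 - x).choose d =
      ∑ x ∈ range k, g x * (k - 1 - x).choose (d + 1) := by
  induction k with
  | zero => simp
  | succ k ih =>
    rw [sum_range_succ, ih, sum_range_succ, ← sum_add_distrib]
    simp only [Nat.add_sub_cancel, Nat.sub_self, Nat.choose_zero_succ, mul_zero, add_zero]
    refine sum_congr rfl fun x hx => ?_
    have hx := mem_range.1 hx
    obtain ⟨e, rfl⟩ : ∃ e, k = x + 1 + e := ⟨k - (x + 1), by omega⟩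
    have h1 : x + 1 + e - 1 - x = e := by omega
    have h2 : x + 1 + e - x = e + 1 := by omega
    rw [h1, h2, Nat.choose_succ_succ]
    ring

theorem sum_range_choose_eq (c k : ℕ) :
    ∑ x ∈ range k, x.choose c = k.choose (c + 1) := by
  induction k with
  | zero => simp
  | succ k ih => rw [sum_range_succ, ih, Nat.choose_succ_succ, add_comm]

theorem sum_Ico_choose_sub (c v l : ℕ) :
    ∑ h ∈ Ico v l, (l - 1 - h).choose c = (l - v).choose (c + 1) := by
  rw [sum_Ico_eq_sum_range, ← sum_range_choose_eq, ← sum_range_reflect (fun x => x.choose c)]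
  refine sum_congr rfl fun x _ => ?_
  congr 1
  omega

/-- Decomposition of all pairs of `c + 1`-chains at the first corner violating `B`. -/
theorem choose_mul_choose_eq_cornerChains_add (B : ℕ → ℕ) (c k l : ℕ) :
    k.choose (c + 1) * l.choose (c + 1) = cornerChains B (c + 1) k l +
      ∑ r ∈ range (c + 1), ∑ x ∈ range k, ∑ y ∈ range l,
        if x < B (y + 1) then
          cornerChains B r x y * ((k - 1 - x).choose (c - r) * (l - 1 - y).choose (c - r))
        else 0 := by
  induction c generalizing k l with
  | zero =>
    simp only [cornerChains, zero_add, Nat.choose_one_right, range_one, sum_singleton,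
      ← sum_add_distrib, Nat.sub_self, Nat.choose_zero_right, mul_one]
    rw [sum_congr rfl fun x _ => sum_congr rfl fun y _ =>
      (show ((if B (y + 1) ≤ x then 1 else 0) + if x < B (y + 1) then 1 else 0) = 1 by
        split_ifs <;> omega)]
    simp
  | succ c ih =>
    have h1 : k.choose (c + 2) * l.choose (c + 2) =
        ∑ x' ∈ range k, ∑ y' ∈ range l, x'.choose (c + 1) * y'.choose (c + 1) := by
      rw [← sum_range_choose_eq (c + 1) k, ← sum_range_choose_eq (c + 1) l, sum_mul_sum]
    have h2 : ∀ r ∈ range (c + 1),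
        ∑ x' ∈ range k, ∑ y' ∈ range l, ∑ x ∈ range x', ∑ y ∈ range y',
          (if x < B (y + 1) then cornerChains B r x y *
            ((x' - 1 - x).choose (c - r) * (y' - 1 - y).choose (c - r)) else 0) =
        ∑ x ∈ range k, ∑ y ∈ range l,
          if x < B (y + 1) then cornerChains B r x y *
            ((k - 1 - x).choose (c + 1 - r) * (l - 1 - y).choose (c + 1 - r)) else 0 := by
      intro r hr
      have hr : c + 1 - r = c - r + 1 := by have := mem_range.1 hr; omega
      rw [hr]
      have e1 : ∀ x' y' x d, ∑ y ∈ range y', (if x < B (y + 1) then cornerChains B r x y *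
            ((x' - 1 - x).choose d * (y' - 1 - y).choose (c - r)) else 0) =
          (∑ y ∈ range y', (if x < B (y + 1) then cornerChains B r x y else 0) *
            (y' - 1 - y).choose (c - r)) * (x' - 1 - x).choose d := by
        intro x' y' x d
        rw [sum_mul]
        refine sum_congr rfl fun y _ => ?_
        split_ifs <;> ring
      simp only [e1]
      have e2 : ∀ x', ∑ y' ∈ range l, ∑ x ∈ range x',
          (∑ y ∈ range y', (if x < B (y + 1) then cornerChains B r x y else 0) *
            (y' - 1 - y).choose (c - r)) * (x' - 1 - x).choose (c - r) =
          ∑ x ∈ range x', (∑ y ∈ range l, (if x < B (y + 1) then cornerChains B r x y else 0) *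
            (l - 1 - y).choose (c - r + 1)) * (x' - 1 - x).choose (c - r) := by
        intro x'
        rw [sum_comm]
        refine sum_congr rfl fun x _ => ?_
        rw [← sum_mul, sum_range_mul_choose]
      simp only [e2]
      rw [sum_range_mul_choose]
      refine sum_congr rfl fun x _ => ?_
      rw [sum_mul]
      refine sum_congr rfl fun y _ => ?_
      split_ifs <;> ring
    have h3 : ∑ x ∈ range k, ∑ y ∈ range l, cornerChains B (c + 1) x y =
        cornerChains B (c + 2) k l + ∑ x ∈ range k, ∑ y ∈ range l,
          if x < B (y + 1) then cornerChains B (c + 1) x y *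
            ((k - 1 - x).choose (c + 1 - (c + 1)) * (l - 1 - y).choose (c + 1 - (c + 1)))
          else 0 := by
      rw [cornerChains, ← sum_add_distrib]
      refine sum_congr rfl fun x' _ => ?_
      rw [← sum_add_distrib]
      refine sum_congr rfl fun y' _ => ?_
      simp only [Nat.sub_self, Nat.choose_zero_right, mul_one]
      split_ifs <;> omega
    rw [h1, sum_range_succ, ← sum_congr rfl h2]
    simp only [ih, sum_add_distrib]
    rw [h3, sum_comm (s := range (c + 1)),
      sum_congr rfl fun x' _ => sum_comm (s := range (c + 1)) (t := range l)]
    ring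

theorem sum_range_partialSum (b f : ℕ → ℕ) (n : ℕ) :
    ∑ x ∈ range (∑ i ∈ range n, b i), f x =
      ∑ h ∈ range n, ∑ o ∈ range (b h), f (∑ i ∈ range h, b i + o) := by
  induction n with
  | zero => simp
  | succ n ih => rw [sum_range_succ (fun i => b i), sum_range_add, ih, sum_range_succ _ n]

theorem partialSum_mono (b : ℕ → ℕ) {s t : ℕ} (h : s ≤ t) :
    ∑ i ∈ range s, b i ≤ ∑ i ∈ range t, b i :=
  sum_le_sum_of_subset (range_subset_range.2 h)

theorem sum_crossings (b : ℕ → ℕ) (φ : ℕ → ℕ → ℕ) (k l : ℕ) (hk : ∑ i ∈ range l, b i ≤ k) :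
    ∑ x ∈ range k, ∑ y ∈ range l, (if x < ∑ i ∈ range (y + 1), b i then φ x y else 0) =
      ∑ h ∈ range l, ∑ o ∈ range (b h), ∑ y ∈ Ico h l, φ (∑ i ∈ range h, b i + o) y := by
  rw [sum_comm]
  have e : ∀ y ∈ range l,
      ∑ x ∈ range k, (if x < ∑ i ∈ range (y + 1), b i then φ x y else 0) =
      ∑ h ∈ range (y + 1), ∑ o ∈ range (b h), φ (∑ i ∈ range h, b i + o) y := by
    intro y hy
    rw [← sum_range_partialSum b (fun x => φ x y), ← sum_filter]
    congr 1
    have : ∑ i ∈ range (y + 1), b i ≤ _ := partialSum_mono b (mem_range.1 hy)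
    ext x
    simp only [mem_filter, mem_range]
    omega
  rw [sum_congr rfl e, sum_congr rfl fun h _ => sum_comm]
  refine sum_comm' fun y h => ?_
  simp only [mem_range, mem_Ico]
  omega

theorem cornerChains_eq_of_lt (b : ℕ → ℕ) {h y x : ℕ} (hy : h ≤ y)
    (hx : x < ∑ i ∈ range (h + 1), b i) (r : ℕ) :
    cornerChains (fun y => ∑ i ∈ range y, b i) r x y =
      cornerChains (fun y => ∑ i ∈ range y, b i) r x h := by
  cases r with
  | zero => rfl
  | succ r =>
    simp only [cornerChains]
    refine sum_congr rfl fun x' hx' => (sum_subset (range_subset_range.2 hy) fun y' _ h2 => ?_).symm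
    have h2 : h + 1 ≤ y' + 1 := by simpa using h2
    have := partialSum_mono b h2
    have := mem_range.1 hx'
    rw [if_neg (by omega)]

/-- Decomposition of all pairs of `c + 1`-chains at the boundary edge over the first violation. -/
theorem choose_mul_choose_eq_cornerChains_add_crossings (b : ℕ → ℕ) (c k l : ℕ)
    (hk : ∑ i ∈ range l, b i ≤ k) :
    k.choose (c + 1) * l.choose (c + 1) =
      cornerChains (fun y => ∑ i ∈ range y, b i) (c + 1) k l +
      ∑ r ∈ range (c + 1), ∑ h ∈ range l, ∑ o ∈ range (b h),
        cornerChains (fun y => ∑ i ∈ range y, b i) r (∑ i ∈ range h, b i + o) h *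
          ((k - 1 - (∑ i ∈ range h, b i + o)).choose (c - r) * (l - h).choose (c - r + 1)) := by
  rw [choose_mul_choose_eq_cornerChains_add (fun y => ∑ i ∈ range y, b i)]
  congr 1
  refine sum_congr rfl fun r _ => ?_
  rw [sum_crossings b (fun x y => cornerChains (fun y => ∑ i ∈ range y, b i) r x y *
    ((k - 1 - x).choose (c - r) * (l - 1 - y).choose (c - r))) k l hk]
  refine sum_congr rfl fun h _ => sum_congr rfl fun o ho => ?_
  rw [← sum_Ico_choose_sub, mul_sum, mul_sum]
  refine sum_congr rfl fun y hy => ?_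
  rw [cornerChains_eq_of_lt b (mem_Ico.1 hy).1]
  rw [sum_range_succ]
  have := mem_range.1 ho
  omega

/-- Reading chains backwards from the crossing point. -/
theorem cornerChains_eq_chainsBelow (B F : ℕ → ℕ) (h : ℕ)
    (hF : ∀ v ≤ h, F v + B (h - v) = F h) (r u v : ℕ) (hv : v ≤ h) :
    cornerChains B r (F h - u) (h - v) = chainsBelow F h r u v := by
  induction r generalizing u v with
  | zero => rfl
  | succ r ih =>
    rw [cornerChains, chainsBelow, sum_comm]
    refine sum_nbij' (fun y => h - 1 - y) (fun v' => h - 1 - v') ?_ ?_ ?_ ?_ ?_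
    · intro y; simp only [mem_range, mem_Ico]; omega
    · intro y; simp only [mem_range, mem_Ico]; omega
    · intro y; simp only [mem_range]; omega
    · intro y; simp only [mem_Ico]; omega
    · intro y hy
      have hy := mem_range.1 hy
      have e1 := hF (h - 1 - y) (by omega)
      have e2 : h - (h - 1 - y) = y + 1 := by omega
      rw [e2] at e1
      rw [← sum_filter]
      refine sum_nbij' (fun x => F h - x) (fun u' => F h - u') ?_ ?_ ?_ ?_ ?_
      · intro x; simp only [mem_filter, mem_range, mem_Ioc]; omega
      · intro x; simp only [mem_filter, mem_range, mem_Ioc]; omega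
      · intro x; simp only [mem_filter, mem_range]; omega
      · intro x; simp only [mem_Ioc]; omega
      · intro x hx
        simp only [mem_filter, mem_range] at hx
        rw [← ih _ _ (by omega)]
        congr 1 <;> omega

theorem choose_eq_add_sum_Ioc (c k u w : ℕ) (h : u ≤ w) (hw : w ≤ k) :
    (k - u).choose (c + 1) = (k - w).choose (c + 1) + ∑ i ∈ Ioc u w, (k - i).choose c := by
  induction w, h using Nat.le_induction with
  | base => simp
  | succ w huw ih =>
    rw [ih (by omega), sum_Ioc_succ_top (by omega)]
    obtain ⟨e, rfl⟩ : ∃ e, k = w + 1 + e := ⟨k - (w + 1), by omega⟩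
    have h1 : w + 1 + e - w = e + 1 := by omega
    have h2 : w + 1 + e - (w + 1) = e := by omega
    rw [h1, h2, Nat.choose_succ_succ]
    ring

theorem sum_Ico_sub_choose (c v l : ℕ) :
    ∑ h ∈ Ico v l, (l - h).choose (c + 1) = (l + 1 - v).choose (c + 2) := by
  rcases le_total v l with h | h
  · rw [← sum_Ico_choose_sub, Nat.Ico_succ_right_eq_insert_Ico h, sum_insert (by simp)]
    simp
  · rw [Ico_eq_empty (by omega), sum_empty, Nat.choose_eq_zero_of_lt (by omega)]

theorem sum_chainsBelow (F : ℕ → ℕ) (hF : Monotone F) (k l : ℕ) (hlt : ∀ h < l, F h < k)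
    (c u v : ℕ) (hu : v < l → u ≤ F v) :
    ∑ r ∈ range (c + 1), ∑ h ∈ Ico v l, chainsBelow F h r u v *
        ((k - 1 - F h).choose (c - r) * (l - h).choose (c - r + 1)) =
      (k - 1 - u).choose c * (l + 1 - v).choose (c + 2) := by
  induction c generalizing u v with
  | zero => simp [chainsBelow, ← sum_Ico_sub_choose]
  | succ c ih =>
    rw [sum_range_succ']
    simp only [chainsBelow, one_mul, Nat.sub_zero, Nat.add_sub_add_right]
    have e1 : ∀ r ∈ range (c + 1), ∑ h ∈ Ico v l,
        (∑ v' ∈ Ico v h, ∑ u' ∈ Ioc u (F v'), chainsBelow F h r u' (v' + 1)) *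
          ((k - 1 - F h).choose (c - r) * (l - h).choose (c - r + 1)) =
        ∑ v' ∈ Ico v l, ∑ u' ∈ Ioc u (F v'), ∑ h ∈ Ico (v' + 1) l,
          chainsBelow F h r u' (v' + 1) *
          ((k - 1 - F h).choose (c - r) * (l - h).choose (c - r + 1)) := by
      intro r _
      simp only [sum_mul]
      rw [sum_comm' (t' := Ico v l) (s' := fun v' => Ico (v' + 1) l)]
      · exact sum_congr rfl fun v' _ => sum_comm
      · intro h v'; simp only [mem_Ico]; omega
    rw [sum_congr rfl e1, sum_comm, ← sum_Ico_sub_choose, mul_sum, ← sum_add_distrib]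
    refine sum_congr rfl fun v' hv' => ?_
    have hv' := mem_Ico.1 hv'
    have hk := hlt v' hv'.2
    rw [sum_comm, choose_eq_add_sum_Ioc c (k - 1) u (F v')
      ((hu (by omega)).trans (hF hv'.1)) (by omega), add_mul, add_comm, sum_mul]
    congr 1
    refine sum_congr rfl fun u' hu' => ?_
    rw [ih u' (v' + 1) fun _ => (mem_Ioc.1 hu').2.trans (hF (Nat.le_succ _))]
    congr 2
    omega

theorem dominated_append_false {b : ℕ → ℕ} {P : List Bool} :
    Dominated b (P ++ [false]) ↔ Dominated b P := by
  constructor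
  · rintro h q r rfl
    exact h q (r ++ [false]) (by simp)
  · intro h q r hqr
    rcases List.eq_nil_or_concat' r with rfl | ⟨r, s, rfl⟩
    · have := List.append_inj_right' hqr rfl
      simp at this
    · rw [show q ++ true :: (r ++ [s]) = (q ++ true :: r) ++ [s] by simp] at hqr
      exact h q r (List.append_inj_left' hqr rfl)

theorem dominated_append_true {b : ℕ → ℕ} {P : List Bool} :
    Dominated b (P ++ [true]) ↔
      Dominated b P ∧ ∑ i ∈ range (P.count true + 1), b i ≤ P.count false := by
  constructor
  · refine fun h => ⟨?_, h P [] rfl⟩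
    rintro q r rfl
    exact h q (r ++ [true]) (by simp)
  · rintro ⟨h, h'⟩ q r hqr
    rcases List.eq_nil_or_concat' r with rfl | ⟨r, s, rfl⟩
    · obtain rfl := List.append_inj_left' hqr rfl
      exact h'
    · rw [show q ++ true :: (r ++ [s]) = (q ++ true :: r) ++ [s] by simp] at hqr
      exact h q r (List.append_inj_left' hqr rfl)

theorem upRightCorners_append_true (P : List Bool) :
    upRightCorners (P ++ [true]) = upRightCorners P := by
  simp only [upRightCorners, List.length_append, List.length_singleton, card_filter,
    sum_range_succ]
  rw [sum_congr rfl fun i hi => ?_, if_neg, add_zero]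
  · simp [List.getD_eq_getElem?_getD]
  · have := mem_range.1 hi
    grind

theorem upRightCorners_append_true_false (P : List Bool) :
    upRightCorners (P ++ [true] ++ [false]) = upRightCorners P + 1 := by
  simp only [upRightCorners, List.length_append, List.length_singleton, card_filter,
    sum_range_succ]
  rw [sum_congr rfl fun i hi => ?_, if_pos, if_neg, add_zero]
  · simp [List.getD_eq_getElem?_getD]
  · simp [List.getD_eq_getElem?_getD]
  · have := mem_range.1 hi
    grind

theorem upRightCorners_append_false_false (P : List Bool) :
    upRightCorners (P ++ [false] ++ [false]) = upRightCorners (P ++ [false]) := by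
  simp only [upRightCorners, List.length_append, List.length_singleton, card_filter,
    sum_range_succ]
  rw [sum_congr rfl fun i hi => ?_, if_neg, if_neg, if_neg, add_zero]
  · simp [List.getD_eq_getElem?_getD]
  · simp [List.getD_eq_getElem?_getD]
  · simp [List.getD_eq_getElem?_getD]
  · have := mem_range.1 hi
    grind

/-- The paths with terminus `(k, l)` dominated by `b` having exactly `c` up-right corners. -/
def dominatedPaths (b : ℕ → ℕ) (k l c : ℕ) : Set (List Bool) :=
  {P | P.count false = k ∧ P.count true = l ∧ Dominated b P ∧ upRightCorners P = c}

theorem finite_dominatedPaths (b : ℕ → ℕ) (k l c : ℕ) : (dominatedPaths b k l c).Finite := by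
  refine (List.finite_length_eq Bool (k + l)).subset ?_
  rintro P ⟨rfl, rfl, -⟩
  exact (P.count_false_add_count_true).symm

theorem ncard_union_append (A A' : Set (List Bool)) (hA : A.Finite) (hA' : A'.Finite) :
    ((· ++ [true]) '' A ∪ (· ++ [false]) '' A').ncard = A.ncard + A'.ncard := by
  rw [Set.ncard_union_eq _ (hA.image _) (hA'.image _),
    Set.ncard_image_of_injective _ (List.append_left_injective _),
    Set.ncard_image_of_injective _ (List.append_left_injective _)]
  rw [Set.disjoint_left]
  rintro _ ⟨P, -, rfl⟩ ⟨Q, -, h⟩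
  have := List.append_inj_right' h rfl
  simp at this

theorem append_true_mem_union {A A' : Set (List Bool)} {P : List Bool} :
    P ++ [true] ∈ (· ++ [true]) '' A ∪ (· ++ [false]) '' A' ↔ P ∈ A := by
  constructor
  · rintro (⟨Q, hQ, h⟩ | ⟨Q, -, h⟩)
    · rwa [← List.append_inj_left' h rfl]
    · have := List.append_inj_right' h rfl
      simp at this
  · exact fun h => Or.inl ⟨P, h, rfl⟩

theorem append_false_mem_union {A A' : Set (List Bool)} {P : List Bool} :
    P ++ [false] ∈ (· ++ [true]) '' A ∪ (· ++ [false]) '' A' ↔ P ∈ A' := by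
  constructor
  · rintro (⟨Q, -, h⟩ | ⟨Q, hQ, h⟩)
    · have := List.append_inj_right' h rfl
      simp at this
    · rwa [← List.append_inj_left' h rfl]
  · exact fun h => Or.inr ⟨P, h, rfl⟩

theorem upRightCorners_replicate (k : ℕ) : upRightCorners (List.replicate k false) = 0 := by
  rw [upRightCorners, card_eq_zero, filter_eq_empty_iff]
  rintro i - ⟨h, -⟩
  simp [List.getD_eq_getElem?_getD, List.getElem?_replicate] at h
  grind

theorem ncard_dominatedPaths_zero (b : ℕ → ℕ) (k c : ℕ) :
    (dominatedPaths b k 0 c).ncard = if c = 0 then 1 else 0 := by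
  have key : ∀ P : List Bool, P.count false = k ∧ P.count true = 0 →
      P = List.replicate k false := by
    rintro P ⟨h1, h2⟩
    rw [List.eq_replicate_iff]
    refine ⟨by rw [← P.count_false_add_count_true]; omega, fun x hx => ?_⟩
    cases x
    · rfl
    · exact absurd hx (List.count_eq_zero.1 h2)
  split_ifs with hc
  · rw [Set.ncard_eq_one]
    refine ⟨List.replicate k false, Set.eq_singleton_iff_unique_mem.2
      ⟨⟨by simp, by simp [List.count_replicate], ?_, ?_⟩, fun P hP => key P ⟨hP.1, hP.2.1⟩⟩⟩
    · intro q r h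
      have : true ∈ List.replicate k false := by rw [h]; simp
      simp at this
    · rw [upRightCorners_replicate, hc]
  · rw [Set.ncard_eq_zero (finite_dominatedPaths _ _ _ _), Set.eq_empty_iff_forall_notMem]
    rintro P ⟨h1, h2, -, h4⟩
    rw [key P ⟨h1, h2⟩, upRightCorners_replicate] at h4
    exact hc h4.symm

theorem finite_preimage_dominatedPaths (b : ℕ → ℕ) (k l c : ℕ) :
    ((· ++ [false]) ⁻¹' dominatedPaths b k l c).Finite :=
  (finite_dominatedPaths b k l c).preimage (List.append_left_injective _).injOn

theorem ncard_dominatedPaths_succ (b : ℕ → ℕ) (k l c : ℕ) (hk : ∑ i ∈ range (l + 1), b i ≤ k) :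
    (dominatedPaths b k (l + 1) c).ncard = (dominatedPaths b k l c).ncard +
      ((· ++ [false]) ⁻¹' dominatedPaths b k (l + 1) c).ncard := by
  rw [← ncard_union_append _ _ (finite_dominatedPaths _ _ _ _)
    (finite_preimage_dominatedPaths _ _ _ _)]
  congr 1
  ext P
  rcases List.eq_nil_or_concat' P with rfl | ⟨P, _ | _, rfl⟩
  · simp [dominatedPaths]
  · rw [append_false_mem_union, Set.mem_preimage]
  · rw [append_true_mem_union]
    simp only [dominatedPaths, Set.mem_ofPred_eq, List.count_append, dominated_append_true,
      upRightCorners_append_true]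
    grind

theorem ncard_preimage_dominatedPaths_succ (b : ℕ → ℕ) (k l c : ℕ) :
    ((· ++ [false]) ⁻¹' dominatedPaths b (k + 1) (l + 1) (c + 1)).ncard =
      (if ∑ i ∈ range (l + 1), b i ≤ k then (dominatedPaths b k l c).ncard else 0) +
      ((· ++ [false]) ⁻¹' dominatedPaths b k (l + 1) (c + 1)).ncard := by
  have h : (if ∑ i ∈ range (l + 1), b i ≤ k then (dominatedPaths b k l c).ncard else 0) =
      {P | P ∈ dominatedPaths b k l c ∧ ∑ i ∈ range (l + 1), b i ≤ k}.ncard := by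
    split_ifs with h <;> simp [h]
  rw [h, ← ncard_union_append _ _ ((finite_dominatedPaths b k l c).subset fun P hP => hP.1)
    (finite_preimage_dominatedPaths _ _ _ _)]
  congr 1
  ext P
  rcases List.eq_nil_or_concat' P with rfl | ⟨P, _ | _, rfl⟩
  · simp [dominatedPaths]
  · rw [append_false_mem_union]
    simp only [dominatedPaths, Set.mem_ofPred_eq, List.count_append, dominated_append_false,
      upRightCorners_append_false_false, Set.mem_preimage]
    grind
  · rw [append_true_mem_union]
    simp only [dominatedPaths, Set.mem_ofPred_eq, List.count_append, dominated_append_false,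
      dominated_append_true, upRightCorners_append_true_false, Set.mem_preimage]
    grind

theorem preimage_dominatedPaths_zero (b : ℕ → ℕ) (k l : ℕ) :
    (· ++ [false]) ⁻¹' dominatedPaths b k (l + 1) 0 = ∅ := by
  rw [Set.eq_empty_iff_forall_notMem]
  intro P
  induction P using List.reverseRecOn generalizing k with
  | nil => simp [dominatedPaths]
  | append_singleton P s ih =>
    rintro ⟨h1, h2, h3, h4⟩
    cases s
    · rw [upRightCorners_append_false_false] at h4
      refine ih (k - 1) ⟨?_, ?_, dominated_append_false.1 h3, h4⟩
      · simp only [List.count_append] at h1 ⊢; simp at h1 ⊢; omega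
      · simpa using h2
    · rw [upRightCorners_append_true_false] at h4
      omega

theorem preimage_dominatedPaths_zero_left (b : ℕ → ℕ) (l c : ℕ) :
    (· ++ [false]) ⁻¹' dominatedPaths b 0 l c = ∅ := by
  rw [Set.eq_empty_iff_forall_notMem]
  rintro P ⟨h, -⟩
  simp at h

/-- Domination need only be tested at the corners and at the terminus. -/
theorem ncard_dominatedPaths (b : ℕ → ℕ) (k l c : ℕ) (hk : ∑ i ∈ range l, b i ≤ k) :
    (dominatedPaths b k l c).ncard = cornerChains (fun y => ∑ i ∈ range y, b i) c k l := by
  induction l generalizing k c with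
  | zero => cases c <;> simp [ncard_dominatedPaths_zero, cornerChains]
  | succ l ih =>
    have hl : ∀ {x}, ∑ i ∈ range (l + 1), b i ≤ x → ∑ i ∈ range l, b i ≤ x :=
      (partialSum_mono b l.le_succ).trans
    rw [ncard_dominatedPaths_succ b k l c hk, ih k c (hl hk)]
    cases c with
    | zero => simp [preimage_dominatedPaths_zero, cornerChains]
    | succ c =>
      have key : ∀ x, ((· ++ [false]) ⁻¹' dominatedPaths b x (l + 1) (c + 1)).ncard =
          ∑ x' ∈ range x, if ∑ i ∈ range (l + 1), b i ≤ x' then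
            cornerChains (fun y => ∑ i ∈ range y, b i) c x' l else 0 := by
        intro x
        induction x with
        | zero => simp [preimage_dominatedPaths_zero_left]
        | succ x ihx =>
          rw [ncard_preimage_dominatedPaths_succ, ihx, sum_range_succ _ x, add_comm]
          congr 1
          split_ifs with h
          · exact ih x c (hl h)
          · rfl
      rw [key, cornerChains, cornerChains, ← sum_add_distrib]
      simp only [sum_range_succ _ l]

/-- The boundary seen backwards from the `o`-th horizontal edge in row `i`. -/
def backwardBoundary (m : ℕ) (a : ℕ → ℕ) (i o v : ℕ) : ℕ :=
  o + ∑ s ∈ range v, a ((i + (s + 1) * (m - 1)) % m)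

theorem backwardBoundary_add_partialSum (m : ℕ) (a : ℕ → ℕ) (j o h v : ℕ) (hm : 0 < m)
    (hv : v ≤ h) :
    backwardBoundary m a ((h + (m - j)) % m) o v + ∑ t ∈ range (h - v), shiftComp m j a t =
      o + ∑ t ∈ range h, shiftComp m j a t := by
  induction v with
  | zero => simp [backwardBoundary]
  | succ v ih =>
    rw [← ih (by omega), backwardBoundary, backwardBoundary, sum_range_succ,
      show h - v = h - (v + 1) + 1 by omega, sum_range_succ (fun t => shiftComp m j a t)]
    have : shiftComp m j a (h - (v + 1)) =
        a (((h + (m - j)) % m + (v + 1) * (m - 1)) % m) := by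
      unfold shiftComp
      congr 1
      rw [Nat.mod_add_mod]
      obtain ⟨e, rfl⟩ : ∃ e, m = e + 1 := ⟨m - 1, by omega⟩
      obtain ⟨d, rfl⟩ : ∃ d, h = v + 1 + d := ⟨h - (v + 1), by omega⟩
      rw [show v + 1 + d - (v + 1) = d by omega, Nat.add_sub_cancel,
        show v + 1 + d + (e + 1 - j) + (v + 1) * e = d + (e + 1 - j) + (e + 1) * (v + 1) by ring,
        Nat.add_mul_mod_self_left]
    omega

theorem backwardBoundary_mono (m : ℕ) (a : ℕ → ℕ) (i o : ℕ) :
    Monotone (backwardBoundary m a i o) := fun _ _ h =>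
  Nat.add_le_add_left (partialSum_mono _ h) o

theorem backwardBoundary_lt (m k l : ℕ) (a : ℕ → ℕ) (hm : 0 < m)
    (hbd : ∀ j < m, ∑ i ∈ range l, a ((j + i) % m) ≤ k) {i o h : ℕ} (hi : i < m) (ho : o < a i)
    (h_lt : h < l) : backwardBoundary m a i o h < k := by
  obtain ⟨l, rfl⟩ : ∃ e, l = e + 1 := ⟨l - 1, by omega⟩
  refine (backwardBoundary_mono m a i o (Nat.le_of_lt_succ h_lt)).trans_lt
    (lt_of_lt_of_le ?_ (hbd ((i + l * (m - 1)) % m) (Nat.mod_lt _ hm)))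
  rw [sum_range_succ, ← sum_range_reflect, backwardBoundary, add_comm]
  refine add_lt_add_of_le_of_lt (le_of_eq (sum_congr rfl fun s hs => ?_)) ?_
  · congr 1
    have hs := mem_range.1 hs
    obtain ⟨e, rfl⟩ : ∃ e, m = e + 1 := ⟨m - 1, by omega⟩
    obtain ⟨d, rfl⟩ : ∃ d, l = s + 1 + d := ⟨l - (s + 1), by omega⟩
    rw [Nat.mod_add_mod, Nat.add_sub_cancel, show s + 1 + d - 1 - s = d by omega,
      show i + (s + 1 + d) * e + d = i + (s + 1) * e + (e + 1) * d by ring,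
      Nat.add_mul_mod_self_left]
  · obtain ⟨e, rfl⟩ : ∃ e, m = e + 1 := ⟨m - 1, by omega⟩
    rw [Nat.mod_add_mod, Nat.add_sub_cancel,
      show i + l * e + l = i + (e + 1) * l by ring, Nat.add_mul_mod_self_left,
      Nat.mod_eq_of_lt hi]
    exact ho

theorem sum_range_rotate (m h : ℕ) (T : ℕ → ℕ) :
    ∑ j ∈ range m, T ((h + (m - j)) % m) = ∑ i ∈ range m, T i := by
  rcases Nat.eq_zero_or_pos m with rfl | hm
  · simp
  have hmap : Set.MapsTo (fun j => (h + (m - j)) % m) (range m) (range m) :=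
    fun j _ => by simpa using Nat.mod_lt _ hm
  have hinj : Set.InjOn (fun j => (h + (m - j)) % m) (range m) := by
    intro x hx y hy hxy
    have hx : x < m := by simpa using hx
    have hy : y < m := by simpa using hy
    have h1 : m - x ≡ m - y [MOD m] := Nat.ModEq.add_left_cancel' h hxy
    have h2 : m - x + (x + y) ≡ m - y + (x + y) [MOD m] := h1.add_right _
    rw [show m - x + (x + y) = m + y by omega, show m - y + (x + y) = m + x by omega] at h2
    have h3 := Nat.ModEq.add_left_cancel' m h2
    exact (h3.eq_of_lt_of_lt hy hx).symm
  exact sum_nbij (fun j => (h + (m - j)) % m) hmap hinj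
    (surjOn_of_injOn_of_card_le _ hmap hinj le_rfl) fun _ _ => rfl

theorem sum_shift_crossings (m k l c : ℕ) (a : ℕ → ℕ) (hm : 0 < m)
    (hbd : ∀ j < m, ∑ i ∈ range l, a ((j + i) % m) ≤ k) :
    ∑ j ∈ range m, ∑ r ∈ range (c + 1), ∑ h ∈ range l, ∑ o ∈ range (shiftComp m j a h),
        cornerChains (fun y => ∑ i ∈ range y, shiftComp m j a i) r
          (∑ i ∈ range h, shiftComp m j a i + o) h *
        ((k - 1 - (∑ i ∈ range h, shiftComp m j a i + o)).choose (c - r) *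
          (l - h).choose (c - r + 1)) =
      (∑ i ∈ range m, a i) * ((k - 1).choose c * (l + 1).choose (c + 2)) := by
  have e : ∀ j r h o, cornerChains (fun y => ∑ i ∈ range y, shiftComp m j a i) r
          (∑ i ∈ range h, shiftComp m j a i + o) h *
        ((k - 1 - (∑ i ∈ range h, shiftComp m j a i + o)).choose (c - r) *
          (l - h).choose (c - r + 1)) =
      chainsBelow (backwardBoundary m a ((h + (m - j)) % m) o) h r 0 0 *
        ((k - 1 - backwardBoundary m a ((h + (m - j)) % m) o h).choose (c - r) *
          (l - h).choose (c - r + 1)) := by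
    intro j r h o
    have h1 := backwardBoundary_add_partialSum m a j o h h hm le_rfl
    simp only [Nat.sub_self, range_zero, sum_empty, add_zero] at h1
    rw [← cornerChains_eq_chainsBelow (fun y => ∑ i ∈ range y, shiftComp m j a i) _ h
      (fun v hv => (backwardBoundary_add_partialSum m a j o h v hm hv).trans h1.symm) r 0 0
      (Nat.zero_le _), h1, Nat.sub_zero, Nat.sub_zero, add_comm o]
  simp only [e]
  rw [sum_comm]
  have e2 : ∀ r, ∑ j ∈ range m, ∑ h ∈ range l, ∑ o ∈ range (shiftComp m j a h),
        chainsBelow (backwardBoundary m a ((h + (m - j)) % m) o) h r 0 0 *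
        ((k - 1 - backwardBoundary m a ((h + (m - j)) % m) o h).choose (c - r) *
          (l - h).choose (c - r + 1)) =
      ∑ i ∈ range m, ∑ o ∈ range (a i), ∑ h ∈ range l,
        chainsBelow (backwardBoundary m a i o) h r 0 0 *
        ((k - 1 - backwardBoundary m a i o h).choose (c - r) *
          (l - h).choose (c - r + 1)) := by
    intro r
    simp only [shiftComp]
    rw [sum_comm, sum_congr rfl fun h _ => sum_range_rotate m h fun i => ∑ o ∈ range (a i),
        chainsBelow (backwardBoundary m a i o) h r 0 0 *
        ((k - 1 - backwardBoundary m a i o h).choose (c - r) *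
          (l - h).choose (c - r + 1)), sum_comm]
    exact sum_congr rfl fun i _ => sum_comm
  simp only [e2]
  rw [sum_comm, sum_mul]
  refine sum_congr rfl fun i hi => ?_
  rw [sum_comm, sum_congr rfl fun o ho => ?_, sum_const, card_range, smul_eq_mul]
  rw [range_eq_Ico (a := l)]
  exact sum_chainsBelow _ (backwardBoundary_mono m a i o) k l
    (fun h hh => backwardBoundary_lt m k l a hm hbd (mem_range.1 hi) (mem_range.1 ho) hh) c 0 0
    fun _ => Nat.zero_le _

theorem partialSum_shiftComp_le (m k l j : ℕ) (a : ℕ → ℕ) (hm : 0 < m)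
    (hbd : ∀ j < m, ∑ i ∈ range l, a ((j + i) % m) ≤ k) :
    ∑ i ∈ range l, shiftComp m j a i ≤ k := by
  refine le_of_eq_of_le (sum_congr rfl fun i _ => ?_) (hbd ((m - j) % m) (Nat.mod_lt _ hm))
  rw [shiftComp, Nat.mod_add_mod, add_comm]

theorem card_pairs_eq_sum_ncard (m k l c : ℕ) (a : ℕ → ℕ) :
    Nat.card {Pj : List Bool × ℕ //
        Pj.2 < m ∧ Pj.1.count false = k ∧ Pj.1.count true = l ∧
        Dominated (shiftComp m Pj.2 a) Pj.1 ∧ upRightCorners Pj.1 = c} =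
      ∑ j ∈ range m, (dominatedPaths (shiftComp m j a) k l c).ncard := by
  have (j : Fin m) : Finite (dominatedPaths (shiftComp m j a) k l c) :=
    finite_dominatedPaths _ _ _ _
  rw [← Fin.sum_univ_eq_sum_range
    (fun j => (dominatedPaths (shiftComp m j a) k l c).ncard)]
  refine Eq.trans (Nat.card_congr (β := Σ j : Fin m, dominatedPaths (shiftComp m j a) k l c)
    { toFun := fun x => ⟨⟨x.1.2, x.2.1⟩, ⟨x.1.1, x.2.2⟩⟩
      invFun := fun y => ⟨(y.2.1, y.1), y.1.2, y.2.2⟩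
      left_inv := fun _ => rfl
      right_inv := fun _ => rfl }) Nat.card_sigma

theorem stmt6 (m n k l c : ℕ) (hm : 0 < m) (a : ℕ → ℕ)
    (hsum : ∑ i ∈ Finset.range m, a i = n)
    (hk : k ≤ n) (hl : l ≤ m)
    (hbd : ∀ j < m, ∑ i ∈ Finset.range l, a ((j + i) % m) ≤ k) :
    ((Nat.card {Pj : List Bool × ℕ //
        Pj.2 < m ∧ Pj.1.count false = k ∧ Pj.1.count true = l ∧
        Dominated (shiftComp m Pj.2 a) Pj.1 ∧ upRightCorners Pj.1 = c} : ℕ) : ℤ) =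
      (m : ℤ) * k.choose c * l.choose c -
        (n : ℤ) * chooseInt (k - 1) ((c : ℤ) - 1) * (l + 1).choose (c + 1) := by
  rw [card_pairs_eq_sum_ncard, sum_congr rfl fun j _ =>
    ncard_dominatedPaths _ k l c (partialSum_shiftComp_le m k l j a hm hbd)]
  cases c with
  | zero => simp [cornerChains, chooseInt]
  | succ c =>
    have h := sum_shift_crossings m k l c a hm hbd
    have htot : ∑ j ∈ range m, k.choose (c + 1) * l.choose (c + 1) = _ :=
      sum_congr rfl fun j _ => choose_mul_choose_eq_cornerChains_add_crossings
        (shiftComp m j a) c k l (partialSum_shiftComp_le m k l j a hm hbd)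
    rw [sum_add_distrib, h, hsum, sum_const, card_range, smul_eq_mul] at htot
    have hc : chooseInt (k - 1) (((c + 1 : ℕ) : ℤ) - 1) = (k - 1).choose c := by
      simp [chooseInt]
    rw [hc]
    zify at htot
    push_cast
    linear_combination -htot
end

section
/- Let m, n be positive integers and let a = (a_0, …, a_{m−1}) be nonnegative integers with a_0 + ⋯ + a_{m−1} = n, and let c ≥ 1. Then the number of pairs (P, j) with 0 ≤ j < m and P a lattice path from (0,0) with terminus (n,m), dominated by σ^j(a), and having exactly c right-up corners (counting an initial U-step as one virtual right-up corner) equals the number of such pairs in which P has exactly c−1 up-right corners, and both numbers equal binomial(n, c−1)·binomial(m, c). -/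
/-- The number of right-up corners of a path: occurrences of an R-step immediately
followed by a U-step, plus one virtual corner if the path begins with a U-step. -/
def rightUpCorners (P : List Bool) : ℕ :=
  ((Finset.range P.length).filter
    (fun i => P.getD i true = false ∧ P.getD (i + 1) false = true)).card +
  (if P.head? = some true then 1 else 0)

/-- The lattice path ending in a U-step (unless empty) whose successive U-steps are preceded by
runs of R-steps of the given lengths. -/
def pathOfRuns : List ℕ → List Bool
  | [] => []
  | k :: t => List.replicate k false ++ true :: pathOfRuns t

lemma pathOfRuns_append (s t : List ℕ) :
    pathOfRuns (s ++ t) = pathOfRuns s ++ pathOfRuns t := by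
  induction s with
  | nil => rfl
  | cons k s ih => simp [pathOfRuns, ih]

lemma count_true_pathOfRuns (t : List ℕ) : (pathOfRuns t).count true = t.length := by
  induction t with
  | nil => rfl
  | cons k t ih => simp [pathOfRuns, ih, List.count_replicate]

lemma count_false_pathOfRuns (t : List ℕ) : (pathOfRuns t).count false = t.sum := by
  induction t with
  | nil => rfl
  | cons k t ih => simp [pathOfRuns, ih]

lemma exists_eq_pathOfRuns_append (P : List Bool) :
    ∃ t k, P = pathOfRuns t ++ List.replicate k false := by
  induction P with
  | nil => exact ⟨[], 0, rfl⟩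
  | cons b P ih =>
    obtain ⟨t, k, rfl⟩ := ih
    cases b with
    | true => exact ⟨0 :: t, k, rfl⟩
    | false =>
      cases t with
      | nil => exact ⟨[], k + 1, rfl⟩
      | cons l t => exact ⟨(l + 1) :: t, k, by simp [pathOfRuns, List.replicate_succ]⟩

lemma replicate_append_cons_inj {k l : ℕ} {Q Q' : List Bool}
    (h : List.replicate k false ++ true :: Q = List.replicate l false ++ true :: Q') :
    k = l ∧ Q = Q' := by
  induction k generalizing l with
  | zero => cases l <;> simp_all [List.replicate_succ]
  | succ k ih =>
    cases l with
    | zero => simp [List.replicate_succ] at h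
    | succ l =>
      simp only [List.replicate_succ, List.cons_append, List.cons.injEq, true_and] at h
      simpa using ih h

lemma pathOfRuns_append_replicate_inj {s t : List ℕ} {k l : ℕ}
    (h : pathOfRuns s ++ List.replicate k false = pathOfRuns t ++ List.replicate l false) :
    s = t := by
  induction s generalizing t with
  | nil =>
    have := congrArg (List.count true) h
    simp [pathOfRuns, count_true_pathOfRuns, List.count_replicate] at this
    exact (List.length_eq_zero_iff.1 (by simpa using this.symm)).symm
  | cons x s ih =>
    cases t with
    | nil =>
      have := congrArg (List.count true) h
      simp [pathOfRuns, count_true_pathOfRuns, List.count_replicate] at this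
    | cons y t =>
      simp only [pathOfRuns, List.append_assoc, List.cons_append] at h
      obtain ⟨rfl, h'⟩ := replicate_append_cons_inj h
      rw [ih h']

lemma pathOfRuns_injective : Function.Injective pathOfRuns := fun s t h =>
  pathOfRuns_append_replicate_inj (k := 0) (l := 0) (by simpa using h)

lemma dominated_pathOfRuns_iff (b : ℕ → ℕ) (t : List ℕ) :
    Dominated b (pathOfRuns t) ↔
      ∀ d < t.length, ∑ i ∈ Finset.range (d + 1), b i ≤ (t.take (d + 1)).sum := by
  constructor
  · intro h d hd
    have key := h (pathOfRuns (t.take d) ++ List.replicate t[d] false)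
      (pathOfRuns (t.drop (d + 1))) (by
        conv_lhs => rw [← List.take_append_drop d t, List.drop_eq_getElem_cons hd]
        rw [pathOfRuns_append, pathOfRuns, List.append_assoc])
    simp only [List.count_append, count_true_pathOfRuns, count_false_pathOfRuns,
      List.length_take, List.count_replicate] at key
    rw [List.take_succ_eq_append_getElem hd, List.sum_append]
    simpa [Nat.min_eq_left hd.le] using key
  · intro h q r hqr
    obtain ⟨s, k, rfl⟩ := exists_eq_pathOfRuns_append q
    obtain ⟨s', k', rfl⟩ := exists_eq_pathOfRuns_append r
    have ht : t = s ++ k :: s' := by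
      apply pathOfRuns_append_replicate_inj (k := 0) (l := k')
      simpa [pathOfRuns_append, pathOfRuns] using hqr
    subst ht
    have key := h s.length (by simp)
    simpa [count_true_pathOfRuns, count_false_pathOfRuns, List.count_replicate,
      List.take_append, List.take_of_length_le] using key

lemma Dominated.exists_eq_pathOfRuns {b : ℕ → ℕ} {P : List Bool} (h : Dominated b P)
    (hP : 0 < P.count true)
    (hb : ∑ i ∈ Finset.range (P.count true), b i = P.count false) :
    ∃ t, P = pathOfRuns t := by
  obtain ⟨t, k, rfl⟩ := exists_eq_pathOfRuns_append P
  have hne : t ≠ [] := by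
    rintro rfl
    simp [pathOfRuns, List.count_replicate] at hP
  obtain ⟨s, l, rfl⟩ := List.eq_nil_or_concat t |>.resolve_left hne
  have key := h (pathOfRuns s ++ List.replicate l false) (List.replicate k false)
    (by simp [pathOfRuns_append, pathOfRuns])
  simp [count_true_pathOfRuns, count_false_pathOfRuns, List.count_replicate] at key hb
  have hk : k = 0 := by omega
  exact ⟨_, by simp [hk]; rfl⟩

lemma upRightCorners_cons (x : Bool) (P : List Bool) :
    upRightCorners (x :: P) =
      (if x = true ∧ P.head? = some false then 1 else 0) + upRightCorners P := by
  unfold upRightCorners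
  rw [Finset.card_filter, Finset.card_filter, List.length_cons, Finset.sum_range_succ', add_comm]
  congr 1
  cases P <;> simp

lemma rightUpCorners_false_cons (P : List Bool) :
    rightUpCorners (false :: P) = rightUpCorners P := by
  unfold rightUpCorners
  rw [Finset.card_filter, Finset.card_filter, List.length_cons, Finset.sum_range_succ']
  cases P <;> simp

lemma rightUpCorners_true_cons (P : List Bool) :
    rightUpCorners (true :: P) + (if P.head? = some true then 1 else 0) =
      rightUpCorners P + 1 := by
  unfold rightUpCorners
  rw [Finset.card_filter, Finset.card_filter, List.length_cons, Finset.sum_range_succ']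
  cases P <;> simp
  omega

lemma head?_pathOfRuns_cons (k : ℕ) (t : List ℕ) :
    (pathOfRuns (k :: t)).head? = some (decide (k = 0)) := by
  cases k <;> simp [pathOfRuns, List.replicate_succ]

lemma upRightCorners_pathOfRuns_cons (k : ℕ) (t : List ℕ) :
    upRightCorners (pathOfRuns (k :: t)) = t.countP (0 < ·) := by
  have step (k : ℕ) (t : List ℕ) : upRightCorners (pathOfRuns (k :: t)) =
      (if (pathOfRuns t).head? = some false then 1 else 0) + upRightCorners (pathOfRuns t) := by
    induction k with
    | zero => simp [pathOfRuns, upRightCorners_cons]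
    | succ k ih =>
      rw [← ih]
      simp [pathOfRuns, List.replicate_succ, upRightCorners_cons]
  induction t generalizing k with
  | nil => rw [step]; simp [pathOfRuns, upRightCorners]
  | cons l t ih =>
    rw [step, ih, head?_pathOfRuns_cons, List.countP_cons]
    simp [Nat.pos_iff_ne_zero, add_comm]

lemma rightUpCorners_pathOfRuns_cons (k : ℕ) (t : List ℕ) :
    rightUpCorners (pathOfRuns (k :: t)) = t.countP (0 < ·) + 1 := by
  have step (k : ℕ) (t : List ℕ) : rightUpCorners (pathOfRuns (k :: t)) =
      rightUpCorners (true :: pathOfRuns t) := by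
    induction k with
    | zero => simp [pathOfRuns]
    | succ k ih =>
      rw [← ih]
      simp [pathOfRuns, List.replicate_succ, rightUpCorners_false_cons]
  induction t generalizing k with
  | nil => rw [step]; simp [pathOfRuns, rightUpCorners]
  | cons l t ih =>
    have h := rightUpCorners_true_cons (pathOfRuns (l :: t))
    rw [ih, head?_pathOfRuns_cons] at h
    rw [step, List.countP_cons]
    rcases Nat.eq_zero_or_pos l with rfl | hl
    · simpa using h
    · simpa [hl, hl.ne'] using h

lemma card_filter_finsuppAntidiag_support_eq {ι : Type*} [DecidableEq ι] {s t : Finset ι}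
    (hts : t ⊆ s) (ht : t.Nonempty) (n : ℕ) :
    ((s.finsuppAntidiag (n + 1)).filter (fun f => f.support = t)).card =
      n.choose (t.card - 1) := by
  have hc : 0 < t.card := ht.card_pos
  rcases le_or_gt t.card (n + 1) with h | h
  · have hsum : ∑ i ∈ t, Finsupp.indicator t (fun _ _ => 1) i = t.card := by
      rw [Finset.card_eq_sum_ones]
      exact Finset.sum_congr rfl fun i hi => by simp [Finsupp.indicator, hi]
    have key : (t.finsuppAntidiag (n + 1 - t.card)).card = n.choose (t.card - 1) := by
      rw [Finset.card_finsuppAntidiag_nat_eq_choose,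
        show t.card + (n + 1 - t.card) - 1 = n by omega, ← Nat.choose_symm (by omega)]
      congr 1
      omega
    rw [← key]
    refine (Finset.card_nbij' (fun f => f + Finsupp.indicator t (fun _ _ => 1))
      (fun f => f - Finsupp.indicator t (fun _ _ => 1)) ?_ ?_ ?_ ?_).symm
    · intro f hf
      simp only [Finset.mem_coe, Finset.mem_finsuppAntidiag, Finset.mem_filter] at hf ⊢
      have hsupp : (f + Finsupp.indicator t (fun _ _ => 1)).support = t := by
        ext i
        by_cases hi : i ∈ t
        · simp [Finsupp.indicator, hi]
        · have : f i = 0 := by simpa using fun h => hi (hf.2 h)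
          simp [Finsupp.indicator, hi, this]
      refine ⟨⟨?_, hsupp.trans_subset hts⟩, hsupp⟩
      rw [← Finset.sum_subset hts]
      · simp only [Finsupp.add_apply, Finset.sum_add_distrib, hf.1, hsum]
        omega
      · intro i _ hi
        rw [← hsupp] at hi
        simpa using hi
    · intro f hf
      simp only [Finset.mem_coe, Finset.mem_finsuppAntidiag, Finset.mem_filter] at hf ⊢
      obtain ⟨⟨h1, -⟩, rfl⟩ := hf
      refine ⟨?_, fun i hi => ?_⟩
      · change ∑ i ∈ f.support, (f i - Finsupp.indicator f.support (fun _ _ => 1) i) = _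
        rw [Finset.sum_tsub_distrib, hsum, Finset.sum_subset hts, h1]
        · intro i _ hi
          simpa using hi
        · intro i hi
          have : f i ≠ 0 := by simpa using hi
          simp [Finsupp.indicator, this]
          omega
      · rw [Finsupp.mem_support_iff, Finsupp.tsub_apply] at hi
        rw [Finsupp.mem_support_iff]
        omega
    · intro f _
      simp
    · intro f hf
      simp only [Finset.mem_coe, Finset.mem_filter] at hf
      obtain ⟨-, rfl⟩ := hf
      ext i
      by_cases hi : f i = 0
      · simp [Finsupp.indicator, hi]
      · simp [Finsupp.indicator, hi]
        omega
  · rw [Nat.choose_eq_zero_of_lt (by omega), Finset.card_eq_zero, Finset.filter_eq_empty_iff]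
    rintro f hf rfl
    rw [Finset.mem_finsuppAntidiag] at hf
    have : ∑ i ∈ f.support, 1 ≤ ∑ i ∈ f.support, f i :=
      Finset.sum_le_sum fun i hi => Nat.one_le_iff_ne_zero.2 (by simpa using hi)
    have h2 : ∑ i ∈ f.support, f i ≤ ∑ i ∈ s, f i :=
      Finset.sum_le_sum_of_subset hf.2
    have h3 : ∑ i ∈ s, f i = n + 1 := hf.1
    simp only [← Finset.card_eq_sum_ones] at this
    omega

lemma card_filter_finsuppAntidiag_card_support {ι : Type*} [DecidableEq ι] (s : Finset ι)
    (n : ℕ) {c : ℕ} (hc : 1 ≤ c) :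
    ((s.finsuppAntidiag (n + 1)).filter (fun f => f.support.card = c)).card =
      n.choose (c - 1) * s.card.choose c := by
  rw [Finset.card_eq_sum_card_fiberwise (f := Finsupp.support) (t := s.powersetCard c)]
  · rw [← Finset.card_powersetCard, mul_comm, ← smul_eq_mul, ← Finset.sum_const]
    refine Finset.sum_congr rfl fun t ht => ?_
    rw [Finset.mem_powersetCard] at ht
    obtain ⟨hts, rfl⟩ := ht
    rw [← card_filter_finsuppAntidiag_support_eq hts (Finset.card_pos.1 hc), Finset.filter_filter]
    congr 1
    refine Finset.filter_congr fun f _ => ?_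
    constructor
    · exact fun h => h.2
    · rintro h
      exact ⟨by rw [h], h⟩
  · intro f hf
    simp only [Finset.coe_filter, Set.mem_ofPred_eq, Finset.mem_finsuppAntidiag] at hf
    simp [Finset.mem_powersetCard, hf.1.2, hf.2]

lemma countP_ofFn {α : Type*} {m : ℕ} (p : α → Bool) (f : Fin m → α) :
    (List.ofFn f).countP p = (Finset.univ.filter (fun i => p (f i) = true)).card := by
  induction m with
  | zero => simp
  | succ m ih =>
    rw [List.ofFn_succ, List.countP_cons, ih, Finset.card_filter, Finset.card_filter,
      Fin.sum_univ_succ, add_comm]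

lemma card_lists_sum_countP_pos (m n : ℕ) {c : ℕ} (hc : 1 ≤ c) :
    Nat.card {L : List ℕ // L.length = m ∧ L.sum = n + 1 ∧ L.countP (0 < ·) = c} =
      n.choose (c - 1) * m.choose c := by
  have key := card_filter_finsuppAntidiag_card_support (Finset.univ : Finset (Fin m)) n hc
  rw [Finset.card_univ, Fintype.card_fin] at key
  rw [← key, ← Nat.card_eq_finsetCard]
  symm
  have hcount (f : Fin m →₀ ℕ) : (List.ofFn f).countP (0 < ·) = f.support.card := by
    rw [countP_ofFn]
    congr 1
    ext i
    simp [Nat.pos_iff_ne_zero]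
  refine Nat.card_congr (Equiv.ofBijective (fun f => ⟨List.ofFn f.1, ?_⟩) ⟨?_, ?_⟩)
  · have hf := f.2
    rw [Finset.mem_filter, Finset.mem_finsuppAntidiag] at hf
    exact ⟨by simp, by rw [List.sum_ofFn]; exact hf.1.1, by rw [hcount]; exact hf.2⟩
  · intro f g h
    simp only [Subtype.mk.injEq, List.ofFn_inj] at h
    exact Subtype.ext (DFunLike.coe_injective h)
  · rintro ⟨L, rfl, hs, hp⟩
    refine ⟨⟨Finsupp.equivFunOnFinite.symm L.get, ?_⟩, ?_⟩
    · rw [Finset.mem_filter, Finset.mem_finsuppAntidiag, ← hcount]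
      simpa [← List.sum_ofFn] using ⟨hs, hp⟩
    · simp

/-- Raney's cycle lemma: a periodic integer sequence whose sum over a period is `1` has exactly
one starting point within a period from which all partial sums are positive. -/
lemma existsUnique_forall_sum_pos_of_periodic {m : ℕ} (hm : 0 < m) {w : ℕ → ℤ}
    (hw : Function.Periodic w m) (hsum : ∑ i ∈ Finset.range m, w i = 1) :
    ∃! j, j < m ∧ ∀ d < m, 0 < ∑ i ∈ Finset.range (d + 1), w (i + (m - j)) := by
  set F : ℕ → ℤ := fun k => ∑ i ∈ Finset.range k, w i with hF
  have hadd (s d : ℕ) : ∑ i ∈ Finset.range d, w (i + s) = F (s + d) - F s := by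
    simp only [hF, Finset.sum_range_add, add_comm _ s]
    ring
  have hper (k : ℕ) : F (k + m) = F k + 1 := by
    simp only [hF]
    rw [add_comm k m, Finset.sum_range_add, hsum, add_comm]
    congr 1
    exact Finset.sum_congr rfl fun i _ => by rw [add_comm m i, hw]
  simp only [hadd, sub_pos]
  have hmin : ∃ s, (1 ≤ s ∧ s ≤ m) ∧ (∀ t, 1 ≤ t → t ≤ m → F s ≤ F t) ∧
      ∀ t, s < t → t ≤ m → F s < F t := by
    obtain ⟨s, hs, hle⟩ := Finset.exists_min_image (Finset.Icc 1 m)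
      (fun s => toLex (F s, -(s : ℤ))) ⟨1, by simp; omega⟩
    simp only [Finset.mem_Icc, Prod.Lex.toLex_le_toLex] at hs hle
    refine ⟨s, hs, fun t h1 h2 => ?_, fun t h1 h2 => ?_⟩
    · rcases hle t ⟨h1, h2⟩ with h | h
      · exact h.le
      · exact h.1.le
    · rcases hle t ⟨by omega, h2⟩ with h | h
      · exact h
      · have := h.2
        omega
  obtain ⟨s, ⟨hs1, hsm⟩, hle, hlt⟩ := hmin
  have hs' : ∀ d < m, F (m - (m - s)) < F (m - (m - s) + (d + 1)) := by
    intro d hd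
    rw [Nat.sub_sub_self hsm]
    rcases le_or_gt (s + (d + 1)) m with h | h
    · exact hlt _ (by omega) h
    · obtain ⟨t, ht⟩ := Nat.exists_eq_add_of_lt h
      have h1 := hle (t + 1) (by omega) (by omega)
      have h2 := hper (t + 1)
      rw [show s + (d + 1) = t + 1 + m by omega]
      omega
  refine ⟨m - s, ⟨by omega, hs'⟩, ?_⟩
  · have aux : ∀ i j : ℕ, i < j → j < m →
        (∀ d < m, F (m - i) < F (m - i + (d + 1))) →
        (∀ d < m, F (m - j) < F (m - j + (d + 1))) → False := by
      intro i j hij hj hi' hj'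
      have h1 := hj' (j - i - 1) (by omega)
      have h2 := hi' (m - (j - i) - 1) (by omega)
      rw [show m - j + (j - i - 1 + 1) = m - i by omega] at h1
      rw [show m - i + (m - (j - i) - 1 + 1) = m - j + m by omega, hper] at h2
      omega
    rintro j ⟨hj, hj'⟩
    rcases lt_trichotomy j (m - s) with h | h | h
    · exact (aux _ _ h (by omega) hj' hs').elim
    · exact h
    · exact (aux _ _ h hj hs' hj').elim

lemma sum_take_eq_sum_range_getD (L : List ℕ) (d : ℕ) :
    (L.take d).sum = ∑ i ∈ Finset.range d, L.getD i 0 := by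
  induction d with
  | zero => simp
  | succ d ih =>
    rw [Finset.sum_range_succ, ← ih]
    rcases lt_or_ge d L.length with h | h
    · rw [List.take_succ_eq_append_getElem h, List.getD_eq_getElem _ _ h, List.sum_append,
        List.sum_singleton]
    · simp [List.take_of_length_le, h, Nat.le_succ_of_le h]

lemma getD_rotate_eq (L : List ℕ) {i j : ℕ} (hi : i < L.length) (hj : j ≤ L.length) :
    L.getD i 0 = (L.rotate j).getD ((i + (L.length - j)) % L.length) 0 := by
  have hpos : 0 < L.length := by omega
  have hlt : (i + (L.length - j)) % L.length < (L.rotate j).length := by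
    rw [List.length_rotate]
    exact Nat.mod_lt _ hpos
  rw [List.getD_eq_getElem _ _ hi, List.getD_eq_getElem _ _ hlt, List.getElem_rotate]
  congr 1
  rw [Nat.mod_add_mod, show i + (L.length - j) + j = i + L.length by omega, Nat.add_mod_right,
    Nat.mod_eq_of_lt hi]

lemma sum_shiftComp (m j : ℕ) (hm : 0 < m) (hj : j < m) (a : ℕ → ℕ) :
    ∑ i ∈ Finset.range m, shiftComp m j a i = ∑ i ∈ Finset.range m, a i := by
  refine Finset.sum_nbij' (fun i => (i + (m - j)) % m) (fun i => (i + j) % m) ?_ ?_ ?_ ?_ ?_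
  · intro i _
    simpa using Nat.mod_lt _ hm
  · intro i _
    simpa using Nat.mod_lt _ hm
  · intro i hi
    rw [Nat.mod_add_mod, show i + (m - j) + j = i + m by omega, Nat.add_mod_right,
      Nat.mod_eq_of_lt (by simpa using hi)]
  · intro i hi
    rw [Nat.mod_add_mod, show i + j + (m - j) = i + m by omega, Nat.add_mod_right,
      Nat.mod_eq_of_lt (by simpa using hi)]
  · intro i _
    rfl

/-- Among the cyclic shifts of a boundary of total `n`, exactly one is strictly dominated by the
corresponding backward rotation of a given list of total `n + 1`. -/
lemma existsUnique_shiftComp_lt {m n : ℕ} (hm : 0 < m) {a : ℕ → ℕ}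
    (ha : ∑ i ∈ Finset.range m, a i = n) {L : List ℕ} (hL : L.length = m)
    (hs : L.sum = n + 1) :
    ∃! j, j < m ∧ ∀ d < m, ∑ i ∈ Finset.range (d + 1), shiftComp m j a i <
      ∑ i ∈ Finset.range (d + 1), L.getD ((i + (m - j)) % m) 0 := by
  have hLs : ∑ i ∈ Finset.range m, L.getD i 0 = n + 1 := by
    rw [← sum_take_eq_sum_range_getD, ← hL, List.take_length, hs]
  have key := existsUnique_forall_sum_pos_of_periodic hm
    (w := fun k => (L.getD (k % m) 0 : ℤ) - a (k % m)) (fun k => by simp) (by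
      rw [Finset.sum_sub_distrib]
      have h1 : ∑ i ∈ Finset.range m, (L.getD (i % m) 0 : ℤ) = n + 1 := by
        rw [← Nat.cast_succ, Nat.succ_eq_add_one, ← hLs, Nat.cast_sum]
        exact Finset.sum_congr rfl fun i hi => by
          rw [Nat.mod_eq_of_lt (Finset.mem_range.1 hi)]
      have h2 : ∑ i ∈ Finset.range m, (a (i % m) : ℤ) = n := by
        rw [← ha, Nat.cast_sum]
        exact Finset.sum_congr rfl fun i hi => by
          rw [Nat.mod_eq_of_lt (Finset.mem_range.1 hi)]
      rw [h1, h2]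
      ring)
  simpa only [Finset.sum_sub_distrib, sub_pos, ← Nat.cast_sum, Nat.cast_lt, shiftComp] using key

/-- Pairs of a list of run lengths of total `n + 1` and a shift of the boundary `a` which
that list strictly dominates. -/
def StrictlyDominatingPair (m n c : ℕ) (a : ℕ → ℕ) (Lj : List ℕ × ℕ) : Prop :=
  Lj.2 < m ∧ Lj.1.length = m ∧ Lj.1.sum = n + 1 ∧ Lj.1.countP (0 < ·) = c ∧
    ∀ d < m, ∑ i ∈ Finset.range (d + 1), shiftComp m Lj.2 a i < (Lj.1.take (d + 1)).sum

lemma sum_take_eq_sum_getD_rotate {m j d : ℕ} {L : List ℕ} (hL : L.length = m) (hj : j < m)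
    (hd : d < m) : (L.take (d + 1)).sum =
      ∑ i ∈ Finset.range (d + 1), (L.rotate j).getD ((i + (m - j)) % m) 0 := by
  subst hL
  rw [sum_take_eq_sum_range_getD]
  refine Finset.sum_congr rfl fun i hi => getD_rotate_eq L ?_ hj.le
  have := Finset.mem_range.1 hi
  omega

lemma card_strictlyDominatingPair {m n : ℕ} (c : ℕ) (hm : 0 < m) {a : ℕ → ℕ}
    (ha : ∑ i ∈ Finset.range m, a i = n) :
    Nat.card {Lj // StrictlyDominatingPair m n c a Lj} =
      Nat.card {L : List ℕ // L.length = m ∧ L.sum = n + 1 ∧ L.countP (0 < ·) = c} := by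
  refine Nat.card_congr (Equiv.ofBijective (fun p => ⟨p.1.1.rotate p.1.2, ?_⟩) ⟨?_, ?_⟩)
  · obtain ⟨⟨L, j⟩, -, h1, h2, h3, -⟩ := p
    exact ⟨by simpa using h1, by rw [(L.rotate_perm j).sum_eq]; exact h2,
      by rw [(L.rotate_perm j).countP_eq]; exact h3⟩
  · rintro ⟨⟨L, j⟩, hj, h1, h2, h3, h4⟩ ⟨⟨L', j'⟩, hj', h1', h2', h3', h4'⟩ h
    simp only [Subtype.mk.injEq] at h hj h1 h2 h3 h4 hj' h1' h2' h3' h4'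
    have hu := existsUnique_shiftComp_lt hm ha (L := L.rotate j) (by simpa using h1)
      (by rw [(L.rotate_perm j).sum_eq]; exact h2)
    have hjj : j = j' := by
      refine hu.unique ⟨hj, fun d hd => ?_⟩ ⟨hj', fun d hd => ?_⟩
      · rw [← sum_take_eq_sum_getD_rotate h1 hj hd]
        exact h4 d hd
      · rw [h, ← sum_take_eq_sum_getD_rotate h1' hj' hd]
        exact h4' d hd
    subst hjj
    exact Subtype.ext (Prod.ext (List.rotate_injective j h) rfl)
  · rintro ⟨L, h1, h2, h3⟩
    obtain ⟨j, ⟨hj, h⟩, -⟩ := existsUnique_shiftComp_lt hm ha h1 h2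
    have hr : (L.rotate (m - j)).rotate j = L := by
      rw [List.rotate_rotate, Nat.sub_add_cancel hj.le, ← h1, List.rotate_length]
    have hp := L.rotate_perm (m - j)
    refine ⟨⟨(L.rotate (m - j), j), hj, by simpa using h1, hp.sum_eq.trans h2,
      (hp.countP_eq _).trans h3, fun d hd => ?_⟩, Subtype.ext hr⟩
    rw [sum_take_eq_sum_getD_rotate (by simpa using h1) hj hd, hr]
    exact h d hd

lemma card_dominated_rightUpCorners_eq {m n c : ℕ} (hm : 0 < m) {a : ℕ → ℕ}
    (ha : ∑ i ∈ Finset.range m, a i = n) :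
    Nat.card {Pj : List Bool × ℕ //
        Pj.2 < m ∧ Pj.1.count false = n ∧ Pj.1.count true = m ∧
        Dominated (shiftComp m Pj.2 a) Pj.1 ∧ rightUpCorners Pj.1 = c} =
      Nat.card {Lj // StrictlyDominatingPair m n c a Lj} := by
  have head_pos {k j : ℕ} {t : List ℕ} (h : StrictlyDominatingPair m n c a (k :: t, j)) :
      0 < k := by
    have := h.2.2.2.2 0 hm
    simp at this
    omega
  symm
  refine Nat.card_congr (Equiv.ofBijective
    (fun p => ⟨(pathOfRuns ((p.1.1.headI - 1) :: p.1.1.tail), p.1.2), ?_⟩) ⟨?_, ?_⟩)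
  · obtain ⟨⟨L, j⟩, h⟩ := p
    obtain _ | ⟨k, t⟩ := L
    · exact absurd h.2.1 hm.ne
    have hk := head_pos h
    obtain ⟨hj, h1, h2, h3, h4⟩ := h
    simp only [List.length_cons, List.sum_cons, List.countP_cons, hk, decide_true, if_true,
      List.take_succ_cons] at h1 h2 h3 h4
    refine ⟨hj, ?_, ?_, ?_, ?_⟩
    · simp only [count_false_pathOfRuns, List.headI_cons, List.tail_cons, List.sum_cons]
      omega
    · simpa [count_true_pathOfRuns] using h1
    · simp only [dominated_pathOfRuns_iff, List.headI_cons, List.tail_cons, List.length_cons,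
        List.take_succ_cons, List.sum_cons]
      intro d hd
      have := h4 d (by omega)
      omega
    · exact (rightUpCorners_pathOfRuns_cons _ _).trans h3
  · rintro ⟨⟨L, j⟩, h⟩ ⟨⟨L', j'⟩, h'⟩ heq
    obtain _ | ⟨k, t⟩ := L
    · exact absurd h.2.1 hm.ne
    obtain _ | ⟨k', t'⟩ := L'
    · exact absurd h'.2.1 hm.ne
    have hk := head_pos h
    have hk' := head_pos h'
    simp only [Subtype.mk.injEq, Prod.mk.injEq, pathOfRuns_injective.eq_iff, List.cons.injEq,
      List.headI_cons, List.tail_cons] at heq ⊢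
    exact ⟨⟨by omega, heq.1.2⟩, heq.2⟩
  · rintro ⟨⟨P, j⟩, hj, h1, h2, h3, h4⟩
    simp only at hj h1 h2 h3 h4
    obtain ⟨L, rfl⟩ := h3.exists_eq_pathOfRuns (by omega) (by
      rw [h2, sum_shiftComp m j hm hj, ha, h1])
    rw [count_false_pathOfRuns] at h1
    rw [count_true_pathOfRuns] at h2
    obtain _ | ⟨k, t⟩ := L
    · exact absurd h2 hm.ne
    rw [rightUpCorners_pathOfRuns_cons] at h4
    rw [dominated_pathOfRuns_iff, h2] at h3
    refine ⟨⟨((k + 1) :: t, j), hj, h2, ?_, ?_, fun d hd => ?_⟩, rfl⟩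
    · simp only [List.sum_cons] at h1 ⊢
      omega
    · simpa using h4
    · have := h3 d hd
      simp only [List.take_succ_cons, List.sum_cons] at this ⊢
      omega

lemma rightUpCorners_eq_upRightCorners_add_one {m n j : ℕ} (hm : 0 < m) (hj : j < m)
    {a : ℕ → ℕ} (ha : ∑ i ∈ Finset.range m, a i = n) {P : List Bool}
    (h1 : P.count false = n) (h2 : P.count true = m) (h3 : Dominated (shiftComp m j a) P) :
    rightUpCorners P = upRightCorners P + 1 := by
  obtain ⟨L, rfl⟩ := h3.exists_eq_pathOfRuns (by omega) (by
    rw [h2, sum_shiftComp m j hm hj, ha, h1])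
  obtain _ | ⟨k, t⟩ := L
  · exact absurd h2 hm.ne
  rw [rightUpCorners_pathOfRuns_cons, upRightCorners_pathOfRuns_cons]

theorem stmt8 (m n c : ℕ) (hm : 0 < m) (hn : 0 < n) (hc : 1 ≤ c) (a : ℕ → ℕ)
    (hsum : ∑ i ∈ Finset.range m, a i = n) :
    Nat.card {Pj : List Bool × ℕ //
        Pj.2 < m ∧ Pj.1.count false = n ∧ Pj.1.count true = m ∧
        Dominated (shiftComp m Pj.2 a) Pj.1 ∧ rightUpCorners Pj.1 = c} =
      Nat.card {Pj : List Bool × ℕ //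
        Pj.2 < m ∧ Pj.1.count false = n ∧ Pj.1.count true = m ∧
        Dominated (shiftComp m Pj.2 a) Pj.1 ∧ upRightCorners Pj.1 = c - 1} ∧
    Nat.card {Pj : List Bool × ℕ //
        Pj.2 < m ∧ Pj.1.count false = n ∧ Pj.1.count true = m ∧
        Dominated (shiftComp m Pj.2 a) Pj.1 ∧ rightUpCorners Pj.1 = c} =
      n.choose (c - 1) * m.choose c := by

  refine ⟨Nat.card_congr (Equiv.subtypeEquivRight ?_), ?_⟩
  · rintro ⟨P, j⟩
    constructor
    · rintro ⟨hj, h1, h2, h3, h4⟩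
      have := rightUpCorners_eq_upRightCorners_add_one hm hj hsum h1 h2 h3
      exact ⟨hj, h1, h2, h3, by dsimp only at h4 this ⊢; omega⟩
    · rintro ⟨hj, h1, h2, h3, h4⟩
      have := rightUpCorners_eq_upRightCorners_add_one hm hj hsum h1 h2 h3
      exact ⟨hj, h1, h2, h3, by dsimp only at h4 this ⊢; omega⟩
  · rw [card_dominated_rightUpCorners_eq hm hsum, card_strictlyDominatingPair c hm hsum,
      card_lists_sum_countP_pos m n hc]
end
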